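/- Let μ be a Borel probability measure on ℝ with μ({0}) ≥ q and finite second moment, and extend the Gaussian density φ to the complex plane by φ(t) = (2π)^{-1/2} e^{-t²/2} for t ∈ ℂ. Then the function d(z;μ) = ∫_ℝ φ(y−z) log(φ(y−z)/p_Y(y;μ)) dy is well defined and holomorphic in z on all of ℂ; consequently x ↦ d(x;μ) is continuous on ℝ. -/

import Mathlib

open MeasureTheory Real Filter

/-- The standard Gaussian density `φ(t) = (2π)^{-1/2} e^{-t²/2}`. -/
noncomputable def gauss (t : ℝ) : ℝ := Real.exp (-t ^ 2 / 2) / Real.sqrt (2 * Real.pi)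

/-- The output density `p_Y(y;μ) = ∫ φ(y−x) dμ(x)`. -/
noncomputable def outDen (μ : Measure ℝ) (y : ℝ) : ℝ := ∫ x, gauss (y - x) ∂μ

/-- The relative entropy `d(x;μ) = ∫ φ(y−x) log(φ(y−x)/p_Y(y;μ)) dy`. -/
noncomputable def relEnt (x : ℝ) (μ : Measure ℝ) : ℝ :=
  ∫ y, gauss (y - x) * Real.log (gauss (y - x) / outDen μ y)

/-- The mutual information `I(μ) = ∫ d(x;μ) dμ(x)`. -/
noncomputable def mutInfo (μ : Measure ℝ) : ℝ := ∫ x, relEnt x μ ∂μ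

/-- The constraint set `Λ(γ,q)`: probability measures with `μ({0}) ≥ q` and second moment
at most `γ`. -/
def memLam (γ q : ℝ) (μ : Measure ℝ) : Prop :=
  IsProbabilityMeasure μ ∧ ENNReal.ofReal q ≤ μ {0} ∧
    ∫⁻ x, ENNReal.ofReal (x ^ 2) ∂μ ≤ ENNReal.ofReal γ

/-- The standard Gaussian density extended to the complex plane:
`φ(t) = (2π)^{-1/2} e^{-t²/2}` for `t ∈ ℂ`. -/
noncomputable def gaussC (t : ℂ) : ℂ := Complex.exp (-t ^ 2 / 2) / (Real.sqrt (2 * Real.pi) : ℂ)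

/-- The entire extension of `log φ`: `log φ(t) = -t²/2 - log √(2π)` for `t ∈ ℂ`. -/
noncomputable def logGaussC (t : ℂ) : ℂ :=
  -t ^ 2 / 2 - (Real.log (Real.sqrt (2 * Real.pi)) : ℂ)

/-- The complex extension of `d(·;μ)`:
`d(z;μ) = ∫_ℝ φ(y−z) (log φ(y−z) − log p_Y(y;μ)) dy`. -/
noncomputable def relEntC (μ : Measure ℝ) (z : ℂ) : ℂ :=
  ∫ y : ℝ, gaussC ((y : ℂ) - z) * (logGaussC ((y : ℂ) - z) - (Real.log (outDen μ y) : ℂ))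

theorem gauss_pos (t : ℝ) : 0 < gauss t := by
  unfold gauss; positivity

theorem one_le_sqrt_two_pi : 1 ≤ Real.sqrt (2 * Real.pi) := by
  rw [Real.one_le_sqrt]
  linarith [Real.pi_gt_three]

theorem gauss_le_one (t : ℝ) : gauss t ≤ 1 := by
  unfold gauss
  rw [div_le_one (by positivity)]
  refine le_trans ?_ one_le_sqrt_two_pi
  rw [Real.exp_le_one_iff]
  nlinarith [sq_nonneg t]

theorem gauss_continuous : Continuous gauss := by
  unfold gauss; fun_prop

theorem gauss_integrable (μ : Measure ℝ) [IsProbabilityMeasure μ] (y : ℝ) :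
    Integrable (fun x => gauss (y - x)) μ := by
  refine Integrable.of_bound (C := 1)
    (gauss_continuous.comp (by fun_prop)).aestronglyMeasurable (ae_of_all _ fun x => ?_)
  rw [Real.norm_eq_abs, abs_of_pos (gauss_pos _)]
  exact gauss_le_one _

theorem outDen_le_one (μ : Measure ℝ) [IsProbabilityMeasure μ] (y : ℝ) : outDen μ y ≤ 1 := by
  unfold outDen
  calc ∫ x, gauss (y - x) ∂μ ≤ ∫ _x, (1 : ℝ) ∂μ :=
        integral_mono (gauss_integrable μ y) (integrable_const _) (fun x => gauss_le_one _)
    _ = 1 := by simp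

theorem outDen_ge (q : ℝ) (μ : Measure ℝ) [IsProbabilityMeasure μ]
    (h0 : ENNReal.ofReal q ≤ μ {0}) (y : ℝ) : q * gauss y ≤ outDen μ y := by
  have h1 : q ≤ μ.real {0} := (ENNReal.ofReal_le_iff_le_toReal (measure_ne_top _ _)).1 h0
  calc q * gauss y ≤ μ.real {0} * gauss y :=
        mul_le_mul_of_nonneg_right h1 (gauss_pos y).le
    _ = ∫ x in {0}, gauss (y - x) ∂μ := by
        simp [Measure.real]
    _ ≤ ∫ x, gauss (y - x) ∂μ :=
        setIntegral_le_integral (gauss_integrable μ y) (ae_of_all _ fun x => (gauss_pos _).le)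

theorem log_gauss (t : ℝ) :
    Real.log (gauss t) = -t ^ 2 / 2 - Real.log (Real.sqrt (2 * Real.pi)) := by
  unfold gauss
  rw [Real.log_div (by positivity) (by positivity), Real.log_exp]

theorem log_outDen_bound (q : ℝ) (hq0 : 0 < q) (μ : Measure ℝ) [IsProbabilityMeasure μ]
    (h0 : ENNReal.ofReal q ≤ μ {0}) :
    ∃ A : ℝ, 0 ≤ A ∧ ∀ y, |Real.log (outDen μ y)| ≤ A + y ^ 2 / 2 := by
  refine ⟨|Real.log q| + |Real.log (Real.sqrt (2 * Real.pi))|, by positivity, fun y => ?_⟩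
  have hpos : 0 < q * gauss y := mul_pos hq0 (gauss_pos y)
  have h1 := outDen_ge q μ h0 y
  have h2 : Real.log (outDen μ y) ≤ 0 :=
    Real.log_nonpos (hpos.le.trans h1) (outDen_le_one μ y)
  have h3 := Real.log_le_log hpos h1
  rw [Real.log_mul hq0.ne' (gauss_pos y).ne', log_gauss] at h3
  rw [abs_of_nonpos h2]
  have := neg_abs_le (Real.log q)
  have := le_abs_self (Real.log (Real.sqrt (2 * Real.pi)))
  linarith

theorem outDen_measurable (μ : Measure ℝ) [IsProbabilityMeasure μ] : Measurable (outDen μ) := by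
  have : StronglyMeasurable (fun p : ℝ × ℝ => gauss (p.1 - p.2)) :=
    (gauss_continuous.comp (by fun_prop)).stronglyMeasurable
  exact this.integral_prod_right.measurable

theorem gaussC_bound (R y : ℝ) (z : ℂ) (hz : ‖z‖ ≤ R) :
    ‖gaussC ((y : ℂ) - z)‖ ≤ Real.exp (R ^ 2 / 2) * Real.exp (-y ^ 2 / 4) := by
  unfold gaussC
  rw [norm_div, Complex.norm_exp, Complex.norm_real, Real.norm_eq_abs,
    abs_of_nonneg (Real.sqrt_nonneg _), ← Real.exp_add]
  refine (div_le_self (Real.exp_pos _).le one_le_sqrt_two_pi).trans ?_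
  rw [Real.exp_le_exp]
  have hre : (-((y : ℂ) - z) ^ 2 / 2).re = -((y - z.re) ^ 2 - z.im ^ 2) / 2 := by
    have : -((y : ℂ) - z) ^ 2 / 2 = ((1 / 2 : ℝ) : ℂ) * (-((y : ℂ) - z) ^ 2) := by
      push_cast; ring
    rw [this, Complex.re_ofReal_mul]
    simp [pow_two]
    ring
  rw [hre]
  have hn : z.re ^ 2 + z.im ^ 2 ≤ R ^ 2 := by
    have h1 := Complex.sq_norm z
    rw [Complex.normSq_apply] at h1
    have : ‖z‖ ^ 2 ≤ R ^ 2 := pow_le_pow_left₀ (norm_nonneg _) hz 2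
    nlinarith
  nlinarith [sq_nonneg (y - 2 * z.re)]

theorem poly_exp_bound (y : ℝ) :
    (1 + y ^ 2) ^ 2 * Real.exp (-y ^ 2 / 4) ≤ 256 * Real.exp (-(1 / 8) * y ^ 2) := by
  have h1 : 1 + y ^ 2 ≤ 16 * Real.exp (y ^ 2 / 16) := by
    have := Real.add_one_le_exp (y ^ 2 / 16)
    linarith
  have h2 : (1 + y ^ 2) ^ 2 ≤ (16 * Real.exp (y ^ 2 / 16)) ^ 2 :=
    pow_le_pow_left₀ (by positivity) h1 2
  calc (1 + y ^ 2) ^ 2 * Real.exp (-y ^ 2 / 4)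
      ≤ (16 * Real.exp (y ^ 2 / 16)) ^ 2 * Real.exp (-y ^ 2 / 4) := by gcongr
    _ = 256 * (Real.exp (y ^ 2 / 16) * Real.exp (y ^ 2 / 16) * Real.exp (-y ^ 2 / 4)) := by ring
    _ = 256 * Real.exp (-(1 / 8) * y ^ 2) := by
      rw [← Real.exp_add, ← Real.exp_add]; congr 2; ring

theorem norm_sub_bound (R y : ℝ) (z : ℂ) (hz : ‖z‖ ≤ R) : ‖(y : ℂ) - z‖ ≤ |y| + R := by
  refine (norm_sub_le _ _).trans ?_
  rw [Complex.norm_real, Real.norm_eq_abs]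
  linarith

theorem log_part_bound (A l R y : ℝ) (z c : ℂ) (hz : ‖z‖ ≤ R) (hA : 0 ≤ A)
    (hl : |l| ≤ A + y ^ 2 / 2) (hc : ‖c‖ ≤ 1) :
    ‖logGaussC ((y : ℂ) - z) - (l : ℂ) + c‖ ≤
      (R ^ 2 + |Real.log (Real.sqrt (2 * Real.pi))| + A + 2) * (1 + y ^ 2) := by
  unfold logGaussC
  set L := Real.log (Real.sqrt (2 * Real.pi))
  have h1 : ‖-((y : ℂ) - z) ^ 2 / 2‖ ≤ y ^ 2 + R ^ 2 := by
    rw [norm_div, norm_neg, norm_pow]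
    have := pow_le_pow_left₀ (norm_nonneg _) (norm_sub_bound R y z hz) 2
    have h2 : ‖(2 : ℂ)‖ = 2 := by simp
    rw [h2]
    nlinarith [sq_nonneg (|y| - R), sq_abs y]
  have h2 : ‖(L : ℂ)‖ = |L| := by rw [Complex.norm_real, Real.norm_eq_abs]
  have h3 : ‖(l : ℂ)‖ = |l| := by rw [Complex.norm_real, Real.norm_eq_abs]
  have h4 := norm_add_le (-((y : ℂ) - z) ^ 2 / 2 - (L : ℂ) - (l : ℂ)) c
  have h5 := norm_sub_le (-((y : ℂ) - z) ^ 2 / 2 - (L : ℂ)) (l : ℂ)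
  have h6 := norm_sub_le (-((y : ℂ) - z) ^ 2 / 2) (L : ℂ)
  have : 0 ≤ (R ^ 2 + |L| + A) * y ^ 2 := by positivity
  nlinarith [sq_nonneg y]

theorem integrand_bound (A l R y : ℝ) (z c w : ℂ) (hz : ‖z‖ ≤ R) (hA : 0 ≤ A)
    (hl : |l| ≤ A + y ^ 2 / 2) (hc : ‖c‖ ≤ 1) (hw : ‖w‖ ≤ (1 + R) * (1 + y ^ 2)) :
    ‖w * gaussC ((y : ℂ) - z) * (logGaussC ((y : ℂ) - z) - (l : ℂ) + c)‖ ≤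
      ((1 + R) * (R ^ 2 + |Real.log (Real.sqrt (2 * Real.pi))| + A + 2) *
        Real.exp (R ^ 2 / 2) * 256) * Real.exp (-(1 / 8) * y ^ 2) := by
  have hR : 0 ≤ R := (norm_nonneg _).trans hz
  have h1 := gaussC_bound R y z hz
  have h2 := log_part_bound A l R y z c hz hA hl hc
  rw [norm_mul, norm_mul]
  set K := R ^ 2 + |Real.log (Real.sqrt (2 * Real.pi))| + A + 2
  have hK : 0 ≤ K := by positivity
  calc _ ≤ ((1 + R) * (1 + y ^ 2)) * (Real.exp (R ^ 2 / 2) * Real.exp (-y ^ 2 / 4)) *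
        (K * (1 + y ^ 2)) := by gcongr
    _ = (1 + R) * K * Real.exp (R ^ 2 / 2) * ((1 + y ^ 2) ^ 2 * Real.exp (-y ^ 2 / 4)) := by ring
    _ ≤ (1 + R) * K * Real.exp (R ^ 2 / 2) * (256 * Real.exp (-(1 / 8) * y ^ 2)) := by
      exact mul_le_mul_of_nonneg_left (poly_exp_bound y) (by positivity)
    _ = _ := by ring

theorem integrand_hasDerivAt (l y : ℝ) (z : ℂ) :
    HasDerivAt (fun z : ℂ => gaussC ((y : ℂ) - z) * (logGaussC ((y : ℂ) - z) - (l : ℂ)))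
      (((y : ℂ) - z) * gaussC ((y : ℂ) - z) * (logGaussC ((y : ℂ) - z) - (l : ℂ) + 1)) z := by
  have h1 : HasDerivAt (fun z : ℂ => (y : ℂ) - z) (-1) z := by
    simpa using (hasDerivAt_id z).const_sub (y : ℂ)
  have h2 : HasDerivAt (fun z : ℂ => -((y : ℂ) - z) ^ 2 / 2) ((y : ℂ) - z) z := by
    refine ((h1.pow 2).neg.div_const 2).congr_deriv ?_
    push_cast
    ring
  have h3 := (h2.cexp.div_const (Real.sqrt (2 * Real.pi) : ℂ))
  have h4 := (h2.sub_const (Real.log (Real.sqrt (2 * Real.pi)) : ℂ)).sub_const (l : ℂ)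
  refine (h3.mul h4).congr_deriv ?_
  unfold gaussC logGaussC
  ring

theorem gaussC_continuous : Continuous gaussC := by
  unfold gaussC; fun_prop

theorem logGaussC_continuous : Continuous logGaussC := by
  unfold logGaussC; fun_prop

theorem relEntC_ofReal (q : ℝ) (hq0 : 0 < q) (μ : Measure ℝ) [IsProbabilityMeasure μ]
    (h0 : ENNReal.ofReal q ≤ μ {0}) (x : ℝ) : relEntC μ (x : ℂ) = (relEnt x μ : ℂ) := by
  unfold relEntC relEnt
  rw [← integral_complex_ofReal]
  congr 1
  ext y
  have hp : 0 < outDen μ y := (mul_pos hq0 (gauss_pos y)).trans_le (outDen_ge q μ h0 y)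
  rw [Real.log_div (gauss_pos _).ne' hp.ne', log_gauss]
  unfold gaussC logGaussC gauss
  push_cast
  ring

/-- for a probability measure `μ` with `μ({0}) ≥ q` and finite second moment, the
extension `z ↦ d(z;μ)` is well defined (the integrand is integrable for every `z ∈ ℂ`) and
holomorphic on all of `ℂ`; consequently `x ↦ d(x;μ)` is continuous on `ℝ`. -/
theorem relEntC_holomorphic (q : ℝ) (hq0 : 0 < q) (μ : Measure ℝ) [IsProbabilityMeasure μ]
    (h0 : ENNReal.ofReal q ≤ μ {0}) (h2 : ∫⁻ x, ENNReal.ofReal (x ^ 2) ∂μ < ⊤) :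
    (∀ z : ℂ, Integrable
        (fun y : ℝ => gaussC ((y : ℂ) - z) * (logGaussC ((y : ℂ) - z) - (Real.log (outDen μ y) : ℂ)))) ∧
      Differentiable ℂ (relEntC μ) ∧
      Continuous (fun x : ℝ => relEnt x μ) := by
  obtain ⟨A, hA, hlog⟩ := log_outDen_bound q hq0 μ h0
  have hlm : Measurable (fun y : ℝ => (Real.log (outDen μ y) : ℂ)) :=
    Complex.measurable_ofReal.comp (Real.measurable_log.comp (outDen_measurable μ))
  have hgm : ∀ z : ℂ, Measurable (fun y : ℝ => gaussC ((y : ℂ) - z)) := fun z =>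
    (gaussC_continuous.comp (by fun_prop)).measurable
  have hLm : ∀ z : ℂ, Measurable (fun y : ℝ => logGaussC ((y : ℂ) - z)) := fun z =>
    (logGaussC_continuous.comp (by fun_prop)).measurable
  have hFm : ∀ z : ℂ, AEStronglyMeasurable (fun y : ℝ => gaussC ((y : ℂ) - z) *
      (logGaussC ((y : ℂ) - z) - (Real.log (outDen μ y) : ℂ))) volume := fun z =>
    ((hgm z).mul ((hLm z).sub hlm)).aestronglyMeasurable
  have hbi : ∀ C : ℝ, Integrable (fun y : ℝ => C * Real.exp (-(1 / 8) * y ^ 2)) := fun C =>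
    (integrable_exp_neg_mul_sq (by norm_num)).const_mul C
  have hint : ∀ z : ℂ, Integrable (fun y : ℝ => gaussC ((y : ℂ) - z) *
      (logGaussC ((y : ℂ) - z) - (Real.log (outDen μ y) : ℂ))) := by
    intro z
    refine (hbi ((1 + ‖z‖) * (‖z‖ ^ 2 + |Real.log (Real.sqrt (2 * Real.pi))| + A + 2) *
        Real.exp (‖z‖ ^ 2 / 2) * 256)).mono' (hFm z) (ae_of_all _ fun y => ?_)
    have := integrand_bound A (Real.log (outDen μ y)) ‖z‖ y z 0 1 le_rfl hA (hlog y) (by simp)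
      (by rw [norm_one]; nlinarith [norm_nonneg z, sq_nonneg y,
            mul_nonneg (norm_nonneg z) (sq_nonneg y)])
    rw [one_mul, add_zero] at this
    exact this
  have hdiff : Differentiable ℂ (relEntC μ) := by
    intro z₀
    have hball : ∀ z ∈ Metric.ball z₀ 1, ‖z‖ ≤ ‖z₀‖ + 1 := by
      intro z hz
      rw [Metric.mem_ball, dist_eq_norm] at hz
      have := norm_add_le z₀ (z - z₀)
      rw [add_sub_cancel] at this
      linarith
    refine (hasDerivAt_integral_of_dominated_loc_of_deriv_le (μ := volume)
      (F := fun (z : ℂ) (y : ℝ) => gaussC ((y : ℂ) - z) *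
        (logGaussC ((y : ℂ) - z) - (Real.log (outDen μ y) : ℂ)))
      (F' := fun (z : ℂ) (y : ℝ) => ((y : ℂ) - z) * gaussC ((y : ℂ) - z) *
        (logGaussC ((y : ℂ) - z) - (Real.log (outDen μ y) : ℂ) + 1))
      (Metric.ball_mem_nhds z₀ one_pos) (Eventually.of_forall hFm) (hint z₀) ?_
      (ae_of_all _ fun y z hz => ?_) (hbi ((1 + (‖z₀‖ + 1)) * ((‖z₀‖ + 1) ^ 2 + |Real.log (Real.sqrt (2 * Real.pi))| + A + 2) *
        Real.exp ((‖z₀‖ + 1) ^ 2 / 2) * 256))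
      (ae_of_all _ fun y z _ => integrand_hasDerivAt _ y z)).2.differentiableAt
    · have h1 : Measurable (fun y : ℝ => (y : ℂ) - z₀) :=
        Complex.measurable_ofReal.sub_const z₀
      exact ((h1.mul (hgm z₀)).mul (((hLm z₀).sub hlm).add_const 1)).aestronglyMeasurable
    · refine integrand_bound A (Real.log (outDen μ y)) (‖z₀‖ + 1) y z 1 _ (hball z hz) hA
        (hlog y) (by simp) ((norm_sub_bound _ y z (hball z hz)).trans ?_)
      have h1 := norm_nonneg z₀
      have h2 := mul_nonneg h1 (sq_nonneg y)
      nlinarith [sq_abs y, sq_nonneg (|y| - 1)]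
  refine ⟨hint, hdiff, ?_⟩
  have : (fun x : ℝ => relEnt x μ) = fun x : ℝ => (relEntC μ (x : ℂ)).re := by
    ext x
    rw [relEntC_ofReal q hq0 μ h0 x, Complex.ofReal_re]
  rw [this]
  exact Complex.continuous_re.comp (hdiff.continuous.comp Complex.continuous_ofReal)
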